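/- (Strict obliqueness estimate.) For every K > 0 there exist constants ε > 0 and C₁₃ > 0, depending only on n, Ω, Ω̃, h, h̃, θ, θ̃ and K, with the following property. Let f ∈ 𝒜 with ‖f‖_{C²(Ω̄ × closure(Ω̃))} ≤ K satisfy condition (OSC) and sup_{Ω̄ × closure(Ω̃)} |D_x f| ≤ ε. Then every smooth uniformly convex solution u of the second boundary value problem with data (f, c) satisfies ⟨∇h(∇u(x)), ν(x)⟩ ≥ 1/C₁₃ > 0 for all x ∈ ∂Ω, where ν(x) = ∇h̃(x) is the inner unit normal of ∂Ω. -/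

import Mathlib

open Set MeasureTheory Matrix
open scoped Topology RealInnerProductSpace NNReal

noncomputable section

abbrev Euc (n : ℕ) := EuclideanSpace ℝ (Fin n)

variable {n : ℕ}

/-- Hessian matrix of `u` at `x`. -/
def Hess (u : Euc n → ℝ) (x : Euc n) : Matrix (Fin n) (Fin n) ℝ :=
  fun i j => iteratedFDeriv ℝ 2 u x ![EuclideanSpace.single i 1, EuclideanSpace.single j 1]

/-- `A ≤ B` in the sense of symmetric matrices. -/
def MatLE (A B : Matrix (Fin n) (Fin n) ℝ) : Prop := (B - A).PosSemidef

/-- The Minkowski mean-curvature operator `div (∇u / √(1 - |∇u|²))`. -/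
def MinkDiv (u : Euc n → ℝ) (x : Euc n) : ℝ :=
  ∑ i, fderiv ℝ (fun y => (Real.sqrt (1 - ‖gradient u y‖ ^ 2))⁻¹ * gradient u y i) x
    (EuclideanSpace.single i 1)

/-- The Euclidean mean-curvature operator `div (∇u / √(1 + |∇u|²))`. -/
def EucDiv (u : Euc n → ℝ) (x : Euc n) : ℝ :=
  ∑ i, fderiv ℝ (fun y => (Real.sqrt (1 + ‖gradient u y‖ ^ 2))⁻¹ * gradient u y i) x
    (EuclideanSpace.single i 1)

/-- `S(p) = (1/v)(Iₙ + p pᵀ / v²)`, `v = √(1-|p|²)`. -/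
def Smat (p : Euc n) : Matrix (Fin n) (Fin n) ℝ :=
  (Real.sqrt (1 - ‖p‖ ^ 2))⁻¹ •
    ((1 : Matrix (Fin n) (Fin n) ℝ) +
      (1 - ‖p‖ ^ 2)⁻¹ • Matrix.vecMulVec (fun i => p i) (fun j => p j))

/-- `B(p) = Iₙ + p pᵀ / (v (1 + v))`, `v = √(1-|p|²)`. -/
def Bmat (p : Euc n) : Matrix (Fin n) (Fin n) ℝ :=
  (1 : Matrix (Fin n) (Fin n) ℝ) +
    (Real.sqrt (1 - ‖p‖ ^ 2) * (1 + Real.sqrt (1 - ‖p‖ ^ 2)))⁻¹ •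
      Matrix.vecMulVec (fun i => p i) (fun j => p j)

/-- `A(x) = (1/v)·B(∇u)·D²u·B(∇u)`: its eigenvalues are the principal curvatures. -/
def Amat (u : Euc n → ℝ) (x : Euc n) : Matrix (Fin n) (Fin n) ℝ :=
  (Real.sqrt (1 - ‖gradient u x‖ ^ 2))⁻¹ •
    (Bmat (gradient u x) * Hess u x * Bmat (gradient u x))

/-- supremum of the quadratic form of `A` over the unit sphere (the operator
norm / largest eigenvalue for a positive semidefinite symmetric `A`). -/
def quadSup (A : Matrix (Fin n) (Fin n) ℝ) : ℝ :=
  ⨆ ξ : Metric.sphere (0 : Euc n) 1,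
    (fun i => (ξ : Euc n) i) ⬝ᵥ A.mulVec (fun i => (ξ : Euc n) i)

/-- The domains `Ω = {h̃ > 0}`, `Ω̃ = {h > 0}` are bounded uniformly convex domains
with smooth boundary, described by the defining functions `h̃` and `h`. -/
def DomainSetup (Ω Ωt : Set (Euc n)) (ht h : Euc n → ℝ) (θt θ : ℝ) : Prop :=
  IsOpen Ω ∧ IsOpen Ωt ∧ Bornology.IsBounded Ω ∧ Bornology.IsBounded Ωt ∧
  Ω.Nonempty ∧ Ωt.Nonempty ∧
  ContDiff ℝ (⊤ : ℕ∞) ht ∧ ContDiff ℝ (⊤ : ℕ∞) h ∧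
  Ω = {x | 0 < ht x} ∧ Ωt = {y | 0 < h y} ∧
  (∀ x ∈ frontier Ω, ‖gradient ht x‖ = 1) ∧
  (∀ y ∈ frontier Ωt, ‖gradient h y‖ = 1) ∧
  0 < θt ∧ 0 < θ ∧
  (∀ x : Euc n, MatLE (Hess ht x) ((-θt) • (1 : Matrix (Fin n) (Fin n) ℝ))) ∧
  (∀ y : Euc n, MatLE (Hess h y) ((-θ) • (1 : Matrix (Fin n) (Fin n) ℝ)))

/-- `f ∈ 𝒜`: `f` is `C²` on `Ω̄ × closure Ω̃` and concave in `x`. -/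
def InA (Ω Ωt : Set (Euc n)) (f : Euc n × Euc n → ℝ) : Prop :=
  ContDiffOn ℝ 2 f (closure Ω ×ˢ closure Ωt) ∧
  ∀ p ∈ closure Ωt, ConcaveOn ℝ (closure Ω) (fun x => f (x, p))

/-- Condition (OSC): `osc f ≤ (n/2)(|Ω̃|/|Ω|)^{1/n}`. -/
def OSCcond (Ω Ωt : Set (Euc n)) (f : Euc n × Euc n → ℝ) : Prop :=
  ∀ x ∈ closure Ω, ∀ y ∈ closure Ω, ∀ p ∈ closure Ωt, ∀ q ∈ closure Ωt,
    |f (x, p) - f (y, q)| ≤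
      ((n : ℝ) / 2) * ((volume Ωt).toReal / (volume Ω).toReal) ^ ((1 : ℝ) / n)

/-- `‖f‖_{C²(Ω̄ × closure Ω̃)} ≤ K`. -/
def C2Bound (Ω Ωt : Set (Euc n)) (f : Euc n × Euc n → ℝ) (K : ℝ) : Prop :=
  ContDiffOn ℝ 2 f (closure Ω ×ˢ closure Ωt) ∧
  ∀ z ∈ closure Ω ×ˢ closure Ωt,
    |f z| ≤ K ∧ ‖fderiv ℝ f z‖ ≤ K ∧ ‖iteratedFDeriv ℝ 2 f z‖ ≤ K

/-- `sup |D_x f| ≤ ε` on `Ω̄ × closure Ω̃`. -/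
def DxBound (Ω Ωt : Set (Euc n)) (f : Euc n × Euc n → ℝ) (ε : ℝ) : Prop :=
  ∀ x ∈ closure Ω, ∀ p ∈ closure Ωt, ‖fderiv ℝ (fun x' => f (x', p)) x‖ ≤ ε

/-- `sup |D_{xp} f| ≤ ε` on `Ω̄ × closure Ω̃`. -/
def DxpBound (Ω Ωt : Set (Euc n)) (f : Euc n × Euc n → ℝ) (ε : ℝ) : Prop :=
  ∀ x ∈ closure Ω, ∀ p ∈ closure Ωt,
    ‖fderiv ℝ (fun p' => fderiv ℝ (fun x' => f (x', p')) x) p‖ ≤ ε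

/-- A strictly convex solution of the second boundary value problem. -/
def IsStrictSol (Ω Ωt : Set (Euc n)) (f : Euc n × Euc n → ℝ) (c : ℝ) (u : Euc n → ℝ) : Prop :=
  ContDiffOn ℝ 2 u (closure Ω) ∧
  (∀ x ∈ closure Ω, (Hess u x).PosDef) ∧
  (∀ x ∈ closure Ω, ‖gradient u x‖ < 1) ∧
  (∀ x ∈ Ω, MinkDiv u x = f (x, gradient u x) + c) ∧
  gradient u '' Ω = Ωt

/-- A smooth uniformly convex solution of the second boundary value problem. -/
def IsSmoothSol (Ω Ωt : Set (Euc n)) (f : Euc n × Euc n → ℝ) (c : ℝ) (u : Euc n → ℝ) : Prop :=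
  ContDiffOn ℝ (⊤ : ℕ∞) u (closure Ω) ∧
  (∃ δ : ℝ, 0 < δ ∧ ∀ x ∈ closure Ω, MatLE (δ • (1 : Matrix (Fin n) (Fin n) ℝ)) (Hess u x)) ∧
  (∀ x ∈ closure Ω, ‖gradient u x‖ < 1) ∧
  (∀ x ∈ Ω, MinkDiv u x = f (x, gradient u x) + c) ∧
  gradient u '' Ω = Ωt

/-- A uniformly convex `C^{2}` solution of the second boundary value problem. -/
def IsUCSol (Ω Ωt : Set (Euc n)) (f : Euc n × Euc n → ℝ) (c : ℝ) (u : Euc n → ℝ) : Prop :=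
  ContDiffOn ℝ 2 u (closure Ω) ∧
  (∃ δ : ℝ, 0 < δ ∧ ∀ x ∈ closure Ω, MatLE (δ • (1 : Matrix (Fin n) (Fin n) ℝ)) (Hess u x)) ∧
  (∀ x ∈ closure Ω, ‖gradient u x‖ < 1) ∧
  (∀ x ∈ Ω, MinkDiv u x = f (x, gradient u x) + c) ∧
  gradient u '' Ω = Ωt

/-- A uniformly convex `C^{4,α}` solution of the second boundary value problem
for the Minkowski mean-curvature operator. -/
def IsC4Sol (Ω Ωt : Set (Euc n)) (f : Euc n × Euc n → ℝ) (c : ℝ) (u : Euc n → ℝ)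
    (α : ℝ) : Prop :=
  ContDiffOn ℝ 4 u (closure Ω) ∧
  (∃ C : ℝ≥0, HolderOnWith C (Real.toNNReal α) (fun x => iteratedFDeriv ℝ 4 u x) (closure Ω)) ∧
  (∃ δ : ℝ, 0 < δ ∧ ∀ x ∈ closure Ω, MatLE (δ • (1 : Matrix (Fin n) (Fin n) ℝ)) (Hess u x)) ∧
  (∀ x ∈ closure Ω, ‖gradient u x‖ < 1) ∧
  (∀ x ∈ Ω, MinkDiv u x = f (x, gradient u x) + c) ∧
  gradient u '' Ω = Ωt

/-- A uniformly convex `C^{4,α}` solution of the second boundary value problem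
for the Euclidean mean-curvature operator. -/
def IsC4SolE (Ω Ωt : Set (Euc n)) (f : Euc n × Euc n → ℝ) (c : ℝ) (u : Euc n → ℝ)
    (α : ℝ) : Prop :=
  ContDiffOn ℝ 4 u (closure Ω) ∧
  (∃ C : ℝ≥0, HolderOnWith C (Real.toNNReal α) (fun x => iteratedFDeriv ℝ 4 u x) (closure Ω)) ∧
  (∃ δ : ℝ, 0 < δ ∧ ∀ x ∈ closure Ω, MatLE (δ • (1 : Matrix (Fin n) (Fin n) ℝ)) (Hess u x)) ∧
  (∀ x ∈ Ω, EucDiv u x = f (x, gradient u x) + c) ∧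
  gradient u '' Ω = Ωt

/-- `ũ` is the Legendre transform of `u`. -/
def IsLegendre (Ω Ωt : Set (Euc n)) (u ut : Euc n → ℝ) : Prop :=
  ContDiffOn ℝ (⊤ : ℕ∞) ut (closure Ωt) ∧
  (∀ x ∈ closure Ω, ut (gradient u x) = ⟪x, gradient u x⟫ - u x) ∧
  (∀ x ∈ closure Ω, gradient ut (gradient u x) = x) ∧
  (∀ x ∈ closure Ω, Hess ut (gradient u x) = (Hess u x)⁻¹)

theorem IsLocalMin.snd_fderiv_nonneg {E : Type*} [NormedAddCommGroup E] [NormedSpace ℝ E]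
    {g : E → ℝ} {g' : E → E →L[ℝ] ℝ} {x ξ : E} {L : E →L[ℝ] ℝ} (hmin : IsLocalMin g x)
    (hg : ∀ᶠ y in 𝓝 x, HasFDerivAt g (g' y) y)
    (hL : HasFDerivAt (fun y => g' y ξ) L x) : 0 ≤ L ξ := by
  by_contra! hneg
  have hline (t : ℝ) : HasDerivAt (fun s : ℝ => x + s • ξ) ξ t := by
    simpa using ((hasDerivAt_id t).smul_const ξ).const_add x
  have htend : Filter.Tendsto (fun s : ℝ => x + s • ξ) (𝓝 0) (𝓝 x) := by
    simpa using (hline 0).continuousAt.tendsto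
  set a : ℝ := -(L ξ) / 4 with ha
  set φ : ℝ → ℝ := fun t => g (x + t • ξ) + a * t ^ 2 with hφ
  have hφ' : ∀ᶠ t in 𝓝 (0 : ℝ), HasDerivAt φ (g' (x + t • ξ) ξ + a * (2 * t)) t := by
    filter_upwards [htend.eventually hg] with t hgt
    have h1 := hgt.comp_hasDerivAt t (hline t)
    have h2 : HasDerivAt (fun t : ℝ => a * t ^ 2) (a * (2 * t)) t := by
      simpa using (hasDerivAt_pow 2 t).const_mul a
    exact h1.add h2
  have hd1 : deriv φ =ᶠ[𝓝 0] fun t => g' (x + t • ξ) ξ + a * (2 * t) :=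
    hφ'.mono fun t h => h.deriv
  have hd2 : HasDerivAt (fun t : ℝ => g' (x + t • ξ) ξ + a * (2 * t)) (L ξ + a * 2) 0 := by
    have hL0 : HasFDerivAt (fun y => g' y ξ) L (x + (0 : ℝ) • ξ) := by simpa using hL
    have h1 := hL0.comp_hasDerivAt (0 : ℝ) (hline 0)
    have h2 : HasDerivAt (fun t : ℝ => a * (2 * t)) (a * 2) 0 := by
      simpa using ((hasDerivAt_id (0 : ℝ)).const_mul 2).const_mul a
    exact h1.add h2
  have hg0 : g' x = 0 := hmin.hasFDerivAt_eq_zero hg.self_of_nhds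
  have hmax : IsLocalMax φ 0 := by
    apply isLocalMax_of_deriv_deriv_neg
    · rw [hd1.deriv_eq, hd2.deriv, ha]; linarith
    · rw [hd1.self_of_nhds]; simp [hg0]
    · exact hφ'.self_of_nhds.continuousAt
  have hev : ∀ᶠ t in 𝓝 (0 : ℝ), a * t ^ 2 ≤ 0 := by
    filter_upwards [hmax, htend.eventually hmin] with t h1 h2
    simp only [hφ, zero_smul, add_zero, ne_eq, OfNat.ofNat_ne_zero, not_false_eq_true, zero_pow,
      mul_zero] at h1
    linarith
  obtain ⟨t, ht, htpos⟩ := ((hev.filter_mono nhdsWithin_le_nhds).and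
    (self_mem_nhdsWithin : Ioi (0 : ℝ) ∈ 𝓝[>] 0)).exists
  have : 0 < a * t ^ 2 := by
    have : 0 < t := htpos
    have : 0 < a := by rw [ha]; linarith
    positivity
  linarith

theorem DifferentiableAt.gradient {u : Euc n → ℝ} {x : Euc n}
    (h : DifferentiableAt ℝ (fderiv ℝ u) x) : DifferentiableAt ℝ (gradient u) x :=
  (InnerProductSpace.toDual ℝ (Euc n)).symm.differentiable.differentiableAt.comp x h

theorem ContDiffAt.gradient {u : Euc n → ℝ} {x : Euc n}
    (h : ContDiffAt ℝ (⊤ : ℕ∞) u x) : ContDiffAt ℝ (⊤ : ℕ∞) (gradient u) x :=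
  (InnerProductSpace.toDual ℝ (Euc n)).symm.contDiff.contDiffAt.comp x
    (h.fderiv_right (m := (⊤ : ℕ∞)) (by simp))

theorem inner_fderiv_gradient {u : Euc n → ℝ} {x : Euc n}
    (h : DifferentiableAt ℝ (fderiv ℝ u) x) (ξ η : Euc n) :
    ⟪fderiv ℝ (gradient u) x ξ, η⟫ = fderiv ℝ (fderiv ℝ u) x ξ η := by
  have h1 : HasFDerivAt (fun y => fderiv ℝ u y η) ((fderiv ℝ (fderiv ℝ u) x).flip η) x := by
    simpa using h.hasFDerivAt.clm_apply (hasFDerivAt_const η x)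
  have h2 := (h.gradient.hasFDerivAt).inner ℝ (hasFDerivAt_const η x)
  simp only [inner_gradient_left] at h2
  have := congrArg (fun L : Euc n →L[ℝ] ℝ => L ξ) (h2.unique h1)
  simpa using this

theorem dotProduct_mulVec_eq_inner (T : Euc n →L[ℝ] Euc n) (M : Matrix (Fin n) (Fin n) ℝ)
    (hM : ∀ i j, M i j = ⟪T (EuclideanSpace.single i 1), EuclideanSpace.single j 1⟫)
    (ξ η : Euc n) : (fun i => ξ i) ⬝ᵥ M *ᵥ (fun i => η i) = ⟪T ξ, η⟫ := by
  have hexp (ζ : Euc n) : ζ = ∑ i, ζ i • EuclideanSpace.single i (1 : ℝ) := by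
    simpa using ((EuclideanSpace.basisFun (Fin n) ℝ).sum_repr ζ).symm
  conv_rhs => rw [hexp ξ, hexp η]
  simp only [map_sum, map_smul, sum_inner, inner_sum, inner_smul_left, inner_smul_right, dotProduct,
    mulVec, hM, Finset.mul_sum]
  rw [Finset.sum_comm]
  refine Finset.sum_congr rfl fun i _ => Finset.sum_congr rfl fun j _ => ?_
  simp
  ring

theorem Hess_apply_eq_inner {u : Euc n → ℝ} {x : Euc n}
    (h : DifferentiableAt ℝ (fderiv ℝ u) x) (i j : Fin n) :
    Hess u x i j =
      ⟪fderiv ℝ (gradient u) x (EuclideanSpace.single i 1), EuclideanSpace.single j 1⟫ := by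
  rw [inner_fderiv_gradient h, Hess, iteratedFDeriv_two_apply]
  rfl

theorem dotProduct_smul_one_mulVec (a : ℝ) (ξ : Euc n) :
    (fun i => ξ i) ⬝ᵥ (a • (1 : Matrix (Fin n) (Fin n) ℝ)) *ᵥ (fun i => ξ i) = a * ‖ξ‖ ^ 2 := by
  rw [smul_mulVec, one_mulVec, dotProduct_smul, EuclideanSpace.norm_sq_eq]
  simp [dotProduct, sq]

/-- A uniform lower Hessian bound forces twice differentiability, also at boundary points. -/
theorem MatLE.differentiableAt_fderiv {u : Euc n → ℝ} {x : Euc n} {δ : ℝ} (hn : 0 < n)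
    (hδ : 0 < δ) (h : MatLE (δ • (1 : Matrix (Fin n) (Fin n) ℝ)) (Hess u x)) :
    DifferentiableAt ℝ (fderiv ℝ u) x := by
  by_contra hd
  have hz : Hess u x = 0 := by
    ext i j
    simp [Hess, iteratedFDeriv_two_apply, fderiv_zero_of_not_differentiableAt hd]
  have h1 := (show (Hess u x - δ • 1).PosSemidef from h).dotProduct_mulVec_nonneg
    (fun i => (EuclideanSpace.single (⟨0, hn⟩ : Fin n) (1 : ℝ) : Euc n) i)
  rw [hz, zero_sub, neg_mulVec, dotProduct_neg, star_trivial, dotProduct_smul_one_mulVec] at h1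
  simp at h1
  linarith

theorem MatLE.le_inner {u : Euc n → ℝ} {x : Euc n} {δ : ℝ}
    (hd : DifferentiableAt ℝ (fderiv ℝ u) x)
    (h : MatLE (δ • (1 : Matrix (Fin n) (Fin n) ℝ)) (Hess u x)) (ξ : Euc n) :
    δ * ‖ξ‖ ^ 2 ≤ ⟪fderiv ℝ (gradient u) x ξ, ξ⟫ := by
  have h1 := (show (Hess u x - δ • 1).PosSemidef from h).dotProduct_mulVec_nonneg (fun i => ξ i)
  rw [sub_mulVec, dotProduct_sub, star_trivial, dotProduct_smul_one_mulVec,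
    dotProduct_mulVec_eq_inner _ _ (Hess_apply_eq_inner hd)] at h1
  linarith

theorem MatLE.inner_le {u : Euc n → ℝ} {x : Euc n} {a : ℝ}
    (hd : DifferentiableAt ℝ (fderiv ℝ u) x)
    (h : MatLE (Hess u x) (a • (1 : Matrix (Fin n) (Fin n) ℝ))) (ξ : Euc n) :
    ⟪fderiv ℝ (gradient u) x ξ, ξ⟫ ≤ a * ‖ξ‖ ^ 2 := by
  have h1 := (show (a • 1 - Hess u x).PosSemidef from h).dotProduct_mulVec_nonneg (fun i => ξ i)
  rw [sub_mulVec, dotProduct_sub, star_trivial, dotProduct_smul_one_mulVec,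
    dotProduct_mulVec_eq_inner _ _ (Hess_apply_eq_inner hd)] at h1
  linarith

theorem MatLE.inner_fderiv_gradient_comm {u : Euc n → ℝ} {x : Euc n} {δ : ℝ}
    (hd : DifferentiableAt ℝ (fderiv ℝ u) x)
    (h : MatLE (δ • (1 : Matrix (Fin n) (Fin n) ℝ)) (Hess u x)) (ξ η : Euc n) :
    ⟪fderiv ℝ (gradient u) x ξ, η⟫ = ⟪fderiv ℝ (gradient u) x η, ξ⟫ := by
  have hS : (Hess u x)ᵀ = Hess u x := by
    have h1 := (show (Hess u x - δ • 1).PosSemidef from h).isHermitian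
    have h2 : (Hess u x - δ • 1)ᵀ = Hess u x - δ • 1 := by simpa using h1.eq
    simpa using h2
  rw [← dotProduct_mulVec_eq_inner _ _ (Hess_apply_eq_inner hd),
    ← dotProduct_mulVec_eq_inner _ _ (Hess_apply_eq_inner hd), dotProduct_mulVec,
    ← mulVec_transpose, hS, dotProduct_comm]

theorem contDiff_gradient {h : Euc n → ℝ} (hh : ContDiff ℝ (⊤ : ℕ∞) h) :
    ContDiff ℝ (⊤ : ℕ∞) (gradient h) :=
  contDiff_iff_contDiffAt.2 fun _ => hh.contDiffAt.gradient

theorem ContDiff.differentiable_fderiv_top {E F : Type*} [NormedAddCommGroup E] [NormedSpace ℝ E]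
    [NormedAddCommGroup F] [NormedSpace ℝ F] {g : E → F} (hg : ContDiff ℝ (⊤ : ℕ∞) g) :
    Differentiable ℝ (fderiv ℝ g) :=
  (hg.fderiv_right (m := (⊤ : ℕ∞)) (by simp)).differentiable (by simp)

/-- A superlevel set of a concave function contains the half-open segments from its points to
points of the weak superlevel set. -/
theorem pos_of_hess_nonpos {h : Euc n → ℝ} (hh : ContDiff ℝ (⊤ : ℕ∞) h)
    (hc : ∀ x ξ : Euc n, ⟪fderiv ℝ (gradient h) x ξ, ξ⟫ ≤ 0) {x y : Euc n} (hy : 0 < h y)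
    (hx : 0 ≤ h x) {t : ℝ} (h0 : 0 ≤ t) (h1 : t < 1) : 0 < h (y + t • (x - y)) := by
  have hline (t : ℝ) : HasDerivAt (fun s : ℝ => y + s • (x - y)) (x - y) t := by
    simpa using ((hasDerivAt_id t).smul_const (x - y)).const_add y
  have hd1 (t : ℝ) : HasDerivAt (fun s : ℝ => h (y + s • (x - y)))
      ⟪gradient h (y + t • (x - y)), x - y⟫ t := by
    rw [inner_gradient_left]
    exact ((hh.differentiable (by simp) _).hasFDerivAt).comp_hasDerivAt t (hline t)
  have hd2 (t : ℝ) : HasDerivAt (fun s : ℝ => ⟪gradient h (y + s • (x - y)), x - y⟫)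
      ⟪fderiv ℝ (gradient h) (y + t • (x - y)) (x - y), x - y⟫ t := by
    have := (((contDiff_gradient hh).differentiable (by simp) _).hasFDerivAt).comp_hasDerivAt t
      (hline t)
    simpa using this.inner ℝ (hasDerivAt_const t (x - y))
  have hderiv : deriv (fun s : ℝ => h (y + s • (x - y))) =
      fun s => ⟪gradient h (y + s • (x - y)), x - y⟫ := funext fun s => (hd1 s).deriv
  have hcon : ConcaveOn ℝ univ (fun s : ℝ => h (y + s • (x - y))) := by
    apply concaveOn_univ_of_deriv2_nonpos (fun s => (hd1 s).differentiableAt)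
    · rw [hderiv]; exact fun s => (hd2 s).differentiableAt
    · intro s
      rw [Function.iterate_succ, Function.iterate_one, Function.comp, hderiv, (hd2 s).deriv]
      exact hc _ _
  have := hcon.2 (mem_univ (0 : ℝ)) (mem_univ (1 : ℝ)) (sub_nonneg.2 h1.le) h0 (by ring)
  simp only [smul_eq_mul, zero_smul, add_zero, one_smul, add_sub_cancel, mul_zero, mul_one,
    zero_add] at this
  have h2 : 0 < (1 - t) * h y := mul_pos (by linarith) hy
  have h3 : 0 ≤ t * h x := mul_nonneg h0 hx
  linarith

theorem sum_smul_single (ξ : Euc n) : ∑ i, ξ i • EuclideanSpace.single i (1 : ℝ) = ξ := by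
  simpa using (EuclideanSpace.basisFun (Fin n) ℝ).sum_repr ξ

theorem MinkDiv_eq {u : Euc n → ℝ} {x : Euc n} (hd : DifferentiableAt ℝ (gradient u) x)
    (hlt : ‖gradient u x‖ < 1) :
    (1 - ‖gradient u x‖ ^ 2) * √(1 - ‖gradient u x‖ ^ 2) * MinkDiv u x =
      (1 - ‖gradient u x‖ ^ 2) * ∑ i, ⟪fderiv ℝ (gradient u) x (EuclideanSpace.single i 1),
        EuclideanSpace.single i 1⟫ +
      ⟪gradient u x, fderiv ℝ (gradient u) x (gradient u x)⟫ := by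
  have hw : 0 < 1 - ‖gradient u x‖ ^ 2 := by
    nlinarith [norm_nonneg (gradient u x)]
  set P := gradient u with hP
  set T := fderiv ℝ P x with hT
  have hPT : HasFDerivAt P T x := hd.hasFDerivAt
  have hs : 0 < √(1 - ‖P x‖ ^ 2) := Real.sqrt_pos.2 hw
  have hss : √(1 - ‖P x‖ ^ 2) * √(1 - ‖P x‖ ^ 2) = 1 - ‖P x‖ ^ 2 := Real.mul_self_sqrt hw.le
  have hinv : HasFDerivAt (fun y => (√(1 - ‖P y‖ ^ 2))⁻¹) _ x :=
    (hasDerivAt_inv hs.ne').comp_hasFDerivAt x ((hPT.norm_sq.const_sub 1).sqrt hw.ne')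
  have hcoord (i : Fin n) : HasFDerivAt (fun y => P y i)
      ((EuclideanSpace.proj (𝕜 := ℝ) i).comp T) x :=
    (EuclideanSpace.proj (𝕜 := ℝ) i).hasFDerivAt.comp x hPT
  have hterm (i : Fin n) : fderiv ℝ (fun y => (√(1 - ‖P y‖ ^ 2))⁻¹ * P y i) x
        (EuclideanSpace.single i 1) =
      (√(1 - ‖P x‖ ^ 2))⁻¹ * ⟪T (EuclideanSpace.single i 1), EuclideanSpace.single i 1⟫ +
        ((1 - ‖P x‖ ^ 2) * √(1 - ‖P x‖ ^ 2))⁻¹ *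
          (P x i * ⟪P x, T (EuclideanSpace.single i 1)⟫) := by
    have hprod : HasFDerivAt (fun y => (√(1 - ‖P y‖ ^ 2))⁻¹ * P y i) _ x := hinv.mul (hcoord i)
    rw [hprod.fderiv]
    simp only [_root_.add_apply, _root_.smul_apply, ContinuousLinearMap.comp_apply,
      _root_.neg_apply, innerSL_apply_apply, smul_eq_mul, PiLp.proj_apply, nsmul_eq_mul,
      EuclideanSpace.inner_single_right, conj_trivial, one_mul]
    generalize √(1 - ‖P x‖ ^ 2) = s at hs hss
    rw [← hss]
    field_simp
    push_cast
    ring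
  have hsum : ∑ i, P x i * ⟪P x, T (EuclideanSpace.single i 1)⟫ = ⟪P x, T (P x)⟫ := by
    conv_rhs => rw [← sum_smul_single (P x), map_sum, inner_sum]
    refine Finset.sum_congr rfl fun i _ => ?_
    rw [sum_smul_single, map_smul, inner_smul_right]
  rw [MinkDiv, Finset.sum_congr rfl fun i _ => hterm i, Finset.sum_add_distrib, ← Finset.mul_sum,
    ← Finset.mul_sum, hsum]
  field_simp

theorem opNorm_le_of_trace {T : Euc n →L[ℝ] Euc n} (hsymm : ∀ ξ η, ⟪T ξ, η⟫ = ⟪T η, ξ⟫)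
    (hpos : ∀ ξ, 0 ≤ ⟪T ξ, ξ⟫) {τ : ℝ}
    (hτ : ∑ i, ⟪T (EuclideanSpace.single i 1), EuclideanSpace.single i 1⟫ ≤ τ) :
    ‖T‖ ≤ n * n * τ := by
  have hdiag (i : Fin n) : ⟪T (EuclideanSpace.single i 1), EuclideanSpace.single i 1⟫ ≤ τ :=
    (Finset.single_le_sum (f := fun i => ⟪T (EuclideanSpace.single i 1),
      EuclideanSpace.single i 1⟫) (fun i _ => hpos _) (Finset.mem_univ i)).trans hτ
  have hτ0 : 0 ≤ τ := (Finset.sum_nonneg fun i _ => hpos _).trans hτ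
  have hentry (i j : Fin n) :
      |⟪T (EuclideanSpace.single i 1), EuclideanSpace.single j 1⟫| ≤ τ := by
    have h1 := hpos (EuclideanSpace.single i 1 + EuclideanSpace.single j 1)
    have h2 := hpos (EuclideanSpace.single i 1 - EuclideanSpace.single j 1)
    simp only [map_add, map_sub, inner_add_left, inner_add_right, inner_sub_left,
      inner_sub_right] at h1 h2
    rw [hsymm (EuclideanSpace.single j 1) (EuclideanSpace.single i 1)] at h1 h2
    rw [abs_le]
    constructor <;> linarith [hdiag i, hdiag j]
  have hcoord (ξ : Euc n) (i : Fin n) : |ξ i| ≤ ‖ξ‖ := by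
    simpa using PiLp.norm_apply_le ξ i
  have hbil (ξ η : Euc n) : |⟪T ξ, η⟫| ≤ n * n * τ * ‖ξ‖ * ‖η‖ := by
    rw [← dotProduct_mulVec_eq_inner T (fun i j => ⟪T (EuclideanSpace.single i 1),
      EuclideanSpace.single j 1⟫) fun _ _ => rfl]
    simp only [dotProduct, mulVec]
    have hb (i j : Fin n) : |⟪T (EuclideanSpace.single i 1), EuclideanSpace.single j 1⟫ * η j| ≤
        τ * ‖η‖ := by
      rw [abs_mul]
      exact mul_le_mul (hentry i j) (hcoord η j) (abs_nonneg _) hτ0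
    have hrow (i : Fin n) : |ξ i * ∑ j, ⟪T (EuclideanSpace.single i 1),
        EuclideanSpace.single j 1⟫ * η j| ≤ ‖ξ‖ * (n * (τ * ‖η‖)) := by
      rw [abs_mul]
      refine mul_le_mul (hcoord ξ i) ?_ (abs_nonneg _) (norm_nonneg _)
      refine (Finset.abs_sum_le_sum_abs _ _).trans
        ((Finset.sum_le_sum fun j _ => hb i j).trans (le_of_eq ?_))
      simp
    refine (Finset.abs_sum_le_sum_abs _ _).trans
      ((Finset.sum_le_sum fun i _ => hrow i).trans (le_of_eq ?_))
    simp
    ring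
  refine T.opNorm_le_bound (by positivity) fun ξ => ?_
  rcases eq_or_ne (T ξ) 0 with h0 | h0
  · rw [h0, norm_zero]; positivity
  · have h := (le_abs_self _).trans (hbil ξ (T ξ))
    rw [real_inner_self_eq_norm_mul_norm] at h
    exact le_of_mul_le_mul_right h (norm_pos_iff.2 h0)

/-- A function with gradient at most one cannot have large Laplacian on a whole ball. -/
theorem trace_le_of_gradient_le_one (hn : 0 < n) {u : Euc n → ℝ} {z : Euc n} {r m : ℝ}
    (hr : 0 < r) (hu : ∀ x ∈ Metric.closedBall z r, DifferentiableAt ℝ u x)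
    (hP : ∀ x ∈ Metric.closedBall z r, DifferentiableAt ℝ (gradient u) x)
    (hle : ∀ x ∈ Metric.closedBall z r, ‖gradient u x‖ ≤ 1)
    (hm : ∀ x ∈ Metric.closedBall z r, m ≤ ∑ i, ⟪fderiv ℝ (gradient u) x
      (EuclideanSpace.single i 1), EuclideanSpace.single i 1⟫) :
    m ≤ 2 * n / r := by
  by_contra! hlt
  have hn' : (0 : ℝ) < n := by exact_mod_cast hn
  obtain ⟨a, ha1, ha2⟩ : ∃ a, 2 / r < a ∧ a < m / n := by
    apply exists_between
    rw [lt_div_iff₀ hn']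
    calc 2 / r * n = 2 * n / r := by ring
      _ < m := hlt
  set g : Euc n → ℝ := fun x => a / 2 * ‖x - z‖ ^ 2 - u x with hg
  set g' : Euc n → Euc n →L[ℝ] ℝ := fun x => innerSL ℝ (a • (x - z) - gradient u x) with hg'
  have hgd (x) (hx : x ∈ Metric.closedBall z r) : HasFDerivAt g (g' x) x := by
    have h1 := ((((hasFDerivAt_id x).sub_const z).norm_sq).const_mul (a / 2)).sub
      (hu x hx).hasFDerivAt
    refine h1.congr_fderiv ?_
    ext ξ
    simp [hg']
    ring
  obtain ⟨y, hy, hymin⟩ := (isCompact_closedBall z r).exists_isMinOn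
    (Metric.nonempty_closedBall.2 hr.le)
    (fun x hx => (hgd x hx).continuousAt.continuousWithinAt : ContinuousOn g _)
  rcases (Metric.mem_closedBall.1 hy).lt_or_eq with hy1 | hy1
  · have hnhds : Metric.closedBall z r ∈ 𝓝 y :=
      Filter.mem_of_superset (Metric.isOpen_ball.mem_nhds hy1) Metric.ball_subset_closedBall
    have hloc : IsLocalMin g y := hymin.isLocalMin hnhds
    have hev : ∀ᶠ x in 𝓝 y, HasFDerivAt g (g' x) x :=
      Filter.mem_of_superset hnhds fun x hx => hgd x hx
    have hdir (i : Fin n) : ⟪fderiv ℝ (gradient u) y (EuclideanSpace.single i 1),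
        EuclideanSpace.single i 1⟫ ≤ a := by
      have h1 := (((((hasFDerivAt_id y).sub_const z).const_smul a).sub
        (hP y hy).hasFDerivAt).inner ℝ (hasFDerivAt_const (EuclideanSpace.single i (1 : ℝ)) y))
      have h2 := hloc.snd_fderiv_nonneg (ξ := EuclideanSpace.single i 1) hev h1
      simp [inner_sub_left, inner_smul_left] at h2
      simpa using h2
    have h3 := Finset.sum_le_sum fun i (_ : i ∈ Finset.univ) => hdir i
    simp only [Finset.sum_const, Finset.card_univ, Fintype.card_fin, nsmul_eq_mul] at h3
    have h4 := (hm y hy).trans h3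
    rw [lt_div_iff₀ hn'] at ha2
    linarith
  · have h1 : g y ≤ g z := hymin (Metric.mem_closedBall_self hr.le)
    have h2 : ‖u y - u z‖ ≤ 1 * ‖y - z‖ :=
      (convex_closedBall z r).norm_image_sub_le_of_norm_fderiv_le (𝕜 := ℝ) hu
        (fun x hx => by
          have := hle x hx
          rwa [gradient, LinearIsometryEquiv.norm_map] at this)
        (Metric.mem_closedBall_self hr.le) hy
    rw [dist_eq_norm] at hy1
    simp only [hg, sub_self, norm_zero, hy1] at h1
    rw [hy1] at h2
    have h3 := (le_abs_self _).trans h2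
    rw [div_lt_iff₀ hr] at ha1
    nlinarith

/-- The derivative of the equation in the direction `η`, with the third derivatives of the
potential of `P` isolated on the left. -/
theorem differentiated_equation {P : Euc n → Euc n} {x : Euc n} {F : Euc n → ℝ}
    {F' : Euc n →L[ℝ] ℝ} (hP : DifferentiableAt ℝ P x) (hP2 : DifferentiableAt ℝ (fderiv ℝ P) x)
    (hlt : ‖P x‖ < 1) (hF : HasFDerivAt F F' x)
    (heq : ∀ᶠ y in 𝓝 x, (1 - ‖P y‖ ^ 2) * √(1 - ‖P y‖ ^ 2) * F y =
      (1 - ‖P y‖ ^ 2) * ∑ i, ⟪fderiv ℝ P y (EuclideanSpace.single i 1),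
        EuclideanSpace.single i 1⟫ + ⟪P y, fderiv ℝ P y (P y)⟫) (η : Euc n) :
    (1 - ‖P x‖ ^ 2) * ∑ i, ⟪fderiv ℝ (fderiv ℝ P) x η (EuclideanSpace.single i 1),
        EuclideanSpace.single i 1⟫ + ⟪P x, fderiv ℝ (fderiv ℝ P) x η (P x)⟫ =
      2 * ⟪P x, fderiv ℝ P x η⟫ * (∑ i, ⟪fderiv ℝ P x (EuclideanSpace.single i 1),
        EuclideanSpace.single i 1⟫) - ⟪fderiv ℝ P x η, fderiv ℝ P x (P x)⟫ -
        ⟪P x, fderiv ℝ P x (fderiv ℝ P x η)⟫ -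
        3 * √(1 - ‖P x‖ ^ 2) * ⟪P x, fderiv ℝ P x η⟫ * F x +
        (1 - ‖P x‖ ^ 2) * √(1 - ‖P x‖ ^ 2) * F' η := by
  have hw : 0 < 1 - ‖P x‖ ^ 2 := by nlinarith [norm_nonneg (P x)]
  have hs : 0 < √(1 - ‖P x‖ ^ 2) := Real.sqrt_pos.2 hw
  have hss : √(1 - ‖P x‖ ^ 2) * √(1 - ‖P x‖ ^ 2) = 1 - ‖P x‖ ^ 2 := Real.mul_self_sqrt hw.le
  have hW : HasFDerivAt (fun y => 1 - ‖P y‖ ^ 2) _ x := hP.hasFDerivAt.norm_sq.const_sub 1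
  have hlhs : HasFDerivAt (fun y => (1 - ‖P y‖ ^ 2) * √(1 - ‖P y‖ ^ 2) * F y) _ x :=
    (hW.mul (hW.sqrt hw.ne')).mul hF
  have htr (i : Fin n) : HasFDerivAt (fun y => ⟪fderiv ℝ P y (EuclideanSpace.single i 1),
      EuclideanSpace.single i 1⟫) _ x :=
    (hP2.hasFDerivAt.clm_apply (hasFDerivAt_const (EuclideanSpace.single i (1 : ℝ)) x)).inner ℝ
      (hasFDerivAt_const (EuclideanSpace.single i (1 : ℝ)) x)
  have hrhs : HasFDerivAt (fun y => (1 - ‖P y‖ ^ 2) * ∑ i, ⟪fderiv ℝ P y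
      (EuclideanSpace.single i 1), EuclideanSpace.single i 1⟫ + ⟪P y, fderiv ℝ P y (P y)⟫) _ x :=
    (hW.mul (HasFDerivAt.fun_sum fun i (_ : i ∈ Finset.univ) => htr i)).add
      (hP.hasFDerivAt.inner ℝ (hP2.hasFDerivAt.clm_apply hP.hasFDerivAt))
  have h := congrArg (fun L : Euc n →L[ℝ] ℝ => L η)
    (hlhs.unique (hrhs.congr_of_eventuallyEq heq))
  simp only [_root_.add_apply, _root_.smul_apply, ContinuousLinearMap.comp_apply,
    _root_.neg_apply, innerSL_apply_apply, smul_eq_mul, nsmul_eq_mul, fderivInnerCLM_apply,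
    ContinuousLinearMap.prod_apply, ContinuousLinearMap.flip_apply, _root_.sum_apply,
    _root_.zero_apply, inner_zero_right, zero_add, map_zero, inner_add_right,
    Nat.cast_ofNat, Pi.mul_apply] at h
  generalize √(1 - ‖P x‖ ^ 2) = s at hs hss h ⊢
  rw [← hss] at h ⊢
  field_simp at h
  linarith

theorem inner_snd_fderiv_comm {P : Euc n → Euc n} {x : Euc n}
    (hP2 : DifferentiableAt ℝ (fderiv ℝ P) x)
    (hsymm : ∀ᶠ y in 𝓝 x, ∀ ξ η, ⟪fderiv ℝ P y ξ, η⟫ = ⟪fderiv ℝ P y η, ξ⟫) (ζ ξ η : Euc n) :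
    ⟪fderiv ℝ (fderiv ℝ P) x ζ ξ, η⟫ = ⟪fderiv ℝ (fderiv ℝ P) x ζ η, ξ⟫ := by
  have hd (ξ η : Euc n) : HasFDerivAt (fun y => ⟪fderiv ℝ P y ξ, η⟫) _ x :=
    (hP2.hasFDerivAt.clm_apply (hasFDerivAt_const ξ x)).inner ℝ (hasFDerivAt_const η x)
  have h := congrArg (fun L : Euc n →L[ℝ] ℝ => L ζ)
    ((hd ξ η).unique ((hd η ξ).congr_of_eventuallyEq (hsymm.mono fun y hy => hy ξ η)))
  simpa using h

theorem norm_third_order_le {P : Euc n → Euc n} {x : Euc n} {F : Euc n → ℝ}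
    {F' : Euc n →L[ℝ] ℝ} (hP : DifferentiableAt ℝ P x) (hP2 : DifferentiableAt ℝ (fderiv ℝ P) x)
    (hlt : ‖P x‖ < 1) (hF : HasFDerivAt F F' x)
    (heq : ∀ᶠ y in 𝓝 x, (1 - ‖P y‖ ^ 2) * √(1 - ‖P y‖ ^ 2) * F y =
      (1 - ‖P y‖ ^ 2) * ∑ i, ⟪fderiv ℝ P y (EuclideanSpace.single i 1),
        EuclideanSpace.single i 1⟫ + ⟪P y, fderiv ℝ P y (P y)⟫)
    (hsymm : ∀ᶠ y in 𝓝 x, ∀ ξ η, ⟪fderiv ℝ P y ξ, η⟫ = ⟪fderiv ℝ P y η, ξ⟫)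
    (hsymm2 : ∀ ξ η, fderiv ℝ (fderiv ℝ P) x ξ η = fderiv ℝ (fderiv ℝ P) x η ξ)
    {Λ τ M K : ℝ} (hΛ : ‖fderiv ℝ P x‖ ≤ Λ)
    (hτ : |∑ i, ⟪fderiv ℝ P x (EuclideanSpace.single i 1), EuclideanSpace.single i 1⟫| ≤ τ)
    (hM : |F x| ≤ M) (hK : ‖F'‖ ≤ K) :
    ‖(1 - ‖P x‖ ^ 2) • ∑ i, fderiv ℝ (fderiv ℝ P) x (EuclideanSpace.single i 1)
        (EuclideanSpace.single i 1) + fderiv ℝ (fderiv ℝ P) x (P x) (P x)‖ ≤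
      2 * Λ * τ + 2 * Λ ^ 2 + 3 * Λ * M + K := by
  set R := (1 - ‖P x‖ ^ 2) • ∑ i, fderiv ℝ (fderiv ℝ P) x (EuclideanSpace.single i 1)
        (EuclideanSpace.single i 1) + fderiv ℝ (fderiv ℝ P) x (P x) (P x) with hR
  have hΛ0 : 0 ≤ Λ := (norm_nonneg _).trans hΛ
  have hτ0 : 0 ≤ τ := (abs_nonneg _).trans hτ
  have hM0 : 0 ≤ M := (abs_nonneg _).trans hM
  have hK0 : 0 ≤ K := (norm_nonneg _).trans hK
  have hw0 : 0 ≤ 1 - ‖P x‖ ^ 2 := by nlinarith [norm_nonneg (P x)]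
  have hw1 : 1 - ‖P x‖ ^ 2 ≤ 1 := by nlinarith [norm_nonneg (P x)]
  have hs0 : 0 ≤ √(1 - ‖P x‖ ^ 2) := Real.sqrt_nonneg _
  have hs1 : √(1 - ‖P x‖ ^ 2) ≤ 1 := Real.sqrt_le_one.2 hw1
  have hinner (η : Euc n) : |⟪R, η⟫| ≤ (2 * Λ * τ + 2 * Λ ^ 2 + 3 * Λ * M + K) * ‖η‖ := by
    have hswap (ξ : Euc n) : ⟪fderiv ℝ (fderiv ℝ P) x ξ ξ, η⟫ =
        ⟪fderiv ℝ (fderiv ℝ P) x η ξ, ξ⟫ := by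
      rw [inner_snd_fderiv_comm hP2 hsymm, hsymm2]
    have hTη : ‖fderiv ℝ P x η‖ ≤ Λ * ‖η‖ := (fderiv ℝ P x).le_of_opNorm_le hΛ η
    have hTP : ‖fderiv ℝ P x (P x)‖ ≤ Λ :=
      ((fderiv ℝ P x).le_of_opNorm_le hΛ _).trans (by nlinarith)
    have hTT : ‖fderiv ℝ P x (fderiv ℝ P x η)‖ ≤ Λ * (Λ * ‖η‖) :=
      ((fderiv ℝ P x).le_of_opNorm_le hΛ _).trans (by gcongr)
    have hPT : |⟪P x, fderiv ℝ P x η⟫| ≤ Λ * ‖η‖ :=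
      (abs_real_inner_le_norm _ _).trans (by nlinarith [norm_nonneg (fderiv ℝ P x η)])
    have hFη : |F' η| ≤ K * ‖η‖ := F'.le_of_opNorm_le hK η
    have e1 : ⟪R, η⟫ = (1 - ‖P x‖ ^ 2) * ∑ i, ⟪fderiv ℝ (fderiv ℝ P) x η
        (EuclideanSpace.single i 1), EuclideanSpace.single i 1⟫ +
        ⟪P x, fderiv ℝ (fderiv ℝ P) x η (P x)⟫ := by
      rw [hR, inner_add_left, inner_smul_left, sum_inner, hswap,
        Finset.sum_congr rfl fun i _ => hswap (EuclideanSpace.single i 1), conj_trivial,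
        real_inner_comm (P x)]
    have b1 : |2 * ⟪P x, fderiv ℝ P x η⟫ * (∑ i, ⟪fderiv ℝ P x (EuclideanSpace.single i 1),
        EuclideanSpace.single i 1⟫)| ≤ 2 * (Λ * ‖η‖) * τ := by
      rw [abs_mul, abs_mul, abs_two]; gcongr
    have b2 : |⟪fderiv ℝ P x η, fderiv ℝ P x (P x)⟫| ≤ Λ * ‖η‖ * Λ :=
      (abs_real_inner_le_norm _ _).trans (by gcongr)
    have b3 : |⟪P x, fderiv ℝ P x (fderiv ℝ P x η)⟫| ≤ 1 * (Λ * (Λ * ‖η‖)) :=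
      (abs_real_inner_le_norm _ _).trans (by gcongr)
    have b4 : |3 * √(1 - ‖P x‖ ^ 2) * ⟪P x, fderiv ℝ P x η⟫ * F x| ≤ 3 * 1 * (Λ * ‖η‖) * M := by
      rw [abs_mul, abs_mul, abs_mul, abs_of_nonneg hs0, abs_of_nonneg (by norm_num : (0 : ℝ) ≤ 3)]
      gcongr
    have b5 : |(1 - ‖P x‖ ^ 2) * √(1 - ‖P x‖ ^ 2) * F' η| ≤ 1 * 1 * (K * ‖η‖) := by
      rw [abs_mul, abs_mul, abs_of_nonneg hs0, abs_of_nonneg hw0]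
      gcongr
    rw [e1, differentiated_equation hP hP2 hlt hF heq η]
    rw [abs_le] at b1 b2 b3 b4 b5 ⊢
    constructor <;> nlinarith
  rcases eq_or_ne R 0 with h0 | h0
  · rw [h0, norm_zero]; positivity
  · have h := (le_abs_self _).trans (hinner R)
    rw [real_inner_self_eq_norm_mul_norm] at h
    exact le_of_mul_le_mul_right h (norm_pos_iff.2 h0)

/-- The barrier `⟨H ∘ P, N⟩ + A h̃`, with `N` the gradient of `h̃`, has no interior minimum. -/
theorem not_isLocalMin_barrier (hn : 0 < n) {P H N : Euc n → Euc n} {ht : Euc n → ℝ} {x : Euc n}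
    {A M Λ C θ : ℝ} (hP : ∀ᶠ y in 𝓝 x, DifferentiableAt ℝ P y)
    (hP2 : DifferentiableAt ℝ (fderiv ℝ P) x) (hlt : ‖P x‖ < 1)
    (hH : Differentiable ℝ H) (hH2 : Differentiable ℝ (fderiv ℝ H))
    (hN : Differentiable ℝ N) (hN2 : Differentiable ℝ (fderiv ℝ N))
    (hht : ∀ y, HasFDerivAt ht (innerSL ℝ (N y)) y)
    (hH0b : ‖H (P x)‖ ≤ M) (hH1b : ‖fderiv ℝ H (P x)‖ ≤ M)
    (hH2b : ‖fderiv ℝ (fderiv ℝ H) (P x)‖ ≤ M)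
    (hN0b : ‖N x‖ ≤ M) (hN1b : ‖fderiv ℝ N x‖ ≤ M) (hN2b : ‖fderiv ℝ (fderiv ℝ N) x‖ ≤ M)
    (hconc : ∀ ξ, ⟪fderiv ℝ N x ξ, ξ⟫ ≤ -θ * ‖ξ‖ ^ 2)
    (hΛ : ‖fderiv ℝ P x‖ ≤ Λ)
    (hR : ‖(1 - ‖P x‖ ^ 2) • ∑ i, fderiv ℝ (fderiv ℝ P) x (EuclideanSpace.single i 1)
        (EuclideanSpace.single i 1) + fderiv ℝ (fderiv ℝ P) x (P x) (P x)‖ ≤ C)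
    (hA0 : 0 ≤ A) (hA : M ^ 2 * (C + (Λ + 1) ^ 2) < A * θ) :
    ¬ IsLocalMin (fun y => ⟪H (P y), N y⟫ + A * ht y) x := by
  intro hmin
  have hM0 : 0 ≤ M := (norm_nonneg _).trans hH0b
  have hΛ0 : 0 ≤ Λ := (norm_nonneg _).trans hΛ
  have hC0 : 0 ≤ C := (norm_nonneg _).trans hR
  have hPx := hP.self_of_nhds
  set W' : Euc n → Euc n →L[ℝ] ℝ := fun y =>
    (fderivInnerCLM ℝ (H (P y), N y)).comp
      (((fderiv ℝ H (P y)).comp (fderiv ℝ P y)).prod (fderiv ℝ N y)) +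
    A • innerSL ℝ (N y) with hW'
  have hW : ∀ᶠ y in 𝓝 x, HasFDerivAt (fun y => ⟪H (P y), N y⟫ + A * ht y) (W' y) y := by
    filter_upwards [hP] with y hy
    exact ((((hH (P y)).hasFDerivAt.comp y hy.hasFDerivAt).inner ℝ (hN y).hasFDerivAt)).add
      ((hht y).const_mul A)
  have hdir (ξ : Euc n) : 0 ≤ ⟪fderiv ℝ H (P x) (fderiv ℝ (fderiv ℝ P) x ξ ξ), N x⟫ +
      (M ^ 2 * (Λ + 1) ^ 2 - A * θ) * ‖ξ‖ ^ 2 := by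
    have hH2P : HasFDerivAt (fun y => fderiv ℝ H (P y)) _ x :=
      (hH2 (P x)).hasFDerivAt.comp x hPx.hasFDerivAt
    have hHP : HasFDerivAt (fun y => H (P y)) _ x := (hH (P x)).hasFDerivAt.comp x hPx.hasFDerivAt
    have hTξ : HasFDerivAt (fun y => fderiv ℝ P y ξ) _ x :=
      hP2.hasFDerivAt.clm_apply (hasFDerivAt_const ξ x)
    have hNξ : HasFDerivAt (fun y => fderiv ℝ N y ξ) _ x :=
      (hN2 x).hasFDerivAt.clm_apply (hasFDerivAt_const ξ x)
    have hd : HasFDerivAt (fun y => ⟪H (P y), fderiv ℝ N y ξ⟫ +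
        ⟪fderiv ℝ H (P y) (fderiv ℝ P y ξ), N y⟫ + A * ⟪N y, ξ⟫) _ x :=
      ((hHP.inner ℝ hNξ).add ((hH2P.clm_apply hTξ).inner ℝ (hN x).hasFDerivAt)).add
        (((hN x).hasFDerivAt.inner ℝ (hasFDerivAt_const ξ x)).const_mul A)
    have h := hmin.snd_fderiv_nonneg (ξ := ξ) hW
      (hd.congr_of_eventuallyEq (Filter.Eventually.of_forall fun y => by simp [hW']))
    simp only [_root_.add_apply, _root_.smul_apply, ContinuousLinearMap.comp_apply, smul_eq_mul,
      fderivInnerCLM_apply, ContinuousLinearMap.prod_apply, ContinuousLinearMap.flip_apply,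
      _root_.zero_apply, inner_zero_right, zero_add, map_zero, inner_add_left] at h
    have hTn : ‖fderiv ℝ P x ξ‖ ≤ Λ * ‖ξ‖ := (fderiv ℝ P x).le_of_opNorm_le hΛ ξ
    have hNn : ‖fderiv ℝ N x ξ‖ ≤ M * ‖ξ‖ := (fderiv ℝ N x).le_of_opNorm_le hN1b ξ
    have hHn : ‖fderiv ℝ H (P x) (fderiv ℝ P x ξ)‖ ≤ M * (Λ * ‖ξ‖) :=
      ((fderiv ℝ H (P x)).le_of_opNorm_le hH1b _).trans (by gcongr)
    have hNN : ‖fderiv ℝ (fderiv ℝ N) x ξ ξ‖ ≤ M * ‖ξ‖ * ‖ξ‖ :=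
      ContinuousLinearMap.le_of_opNorm_le _ (ContinuousLinearMap.le_of_opNorm_le _ hN2b ξ) ξ
    have hHH : ‖fderiv ℝ (fderiv ℝ H) (P x) (fderiv ℝ P x ξ) (fderiv ℝ P x ξ)‖ ≤
        M * (Λ * ‖ξ‖) * (Λ * ‖ξ‖) :=
      (ContinuousLinearMap.le_of_opNorm_le _
        (ContinuousLinearMap.le_of_opNorm_le _ hH2b _) _).trans (by gcongr)
    have b1 : ⟪H (P x), fderiv ℝ (fderiv ℝ N) x ξ ξ⟫ ≤ M * (M * ‖ξ‖ * ‖ξ‖) :=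
      (real_inner_le_norm _ _).trans (by gcongr)
    have b2 : ⟪fderiv ℝ H (P x) (fderiv ℝ P x ξ), fderiv ℝ N x ξ⟫ ≤ M * (Λ * ‖ξ‖) * (M * ‖ξ‖) :=
      (real_inner_le_norm _ _).trans (by gcongr)
    have b3 : ⟪fderiv ℝ (fderiv ℝ H) (P x) (fderiv ℝ P x ξ) (fderiv ℝ P x ξ), N x⟫ ≤
        M * (Λ * ‖ξ‖) * (Λ * ‖ξ‖) * M :=
      (real_inner_le_norm _ _).trans (by gcongr)
    have b4 := mul_le_mul_of_nonneg_left (hconc ξ) hA0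
    nlinarith
  have hsum := add_nonneg (mul_nonneg (by nlinarith [norm_nonneg (P x)] : 0 ≤ 1 - ‖P x‖ ^ 2)
    (Finset.sum_nonneg fun i (_ : i ∈ Finset.univ) => hdir (EuclideanSpace.single i 1)))
    (hdir (P x))
  have hinner : ⟪fderiv ℝ H (P x) ((1 - ‖P x‖ ^ 2) • ∑ i, fderiv ℝ (fderiv ℝ P) x
      (EuclideanSpace.single i 1) (EuclideanSpace.single i 1) +
        fderiv ℝ (fderiv ℝ P) x (P x) (P x)), N x⟫ ≤ M * C * M :=
    (real_inner_le_norm _ _).trans (mul_le_mul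
      (((fderiv ℝ H (P x)).le_of_opNorm_le hH1b _).trans (by gcongr)) hN0b (norm_nonneg _)
      (by positivity))
  simp only [map_add, map_smul, map_sum, inner_add_left, inner_smul_left, sum_inner,
    conj_trivial] at hinner
  simp only [Finset.sum_add_distrib, PiLp.norm_single, norm_one,
    one_pow, Finset.sum_const, Finset.card_univ, Fintype.card_fin, nsmul_eq_mul, mul_one] at hsum
  have hn1 : (1 : ℝ) ≤ n := by exact_mod_cast hn
  have hw0 : 0 ≤ 1 - ‖P x‖ ^ 2 := by nlinarith [norm_nonneg (P x)]
  have hneg : M ^ 2 * (Λ + 1) ^ 2 - A * θ ≤ 0 := by nlinarith [mul_nonneg (sq_nonneg M) hC0]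
  have hweight : 1 ≤ (1 - ‖P x‖ ^ 2) * n + ‖P x‖ ^ 2 := by nlinarith
  have := mul_le_mul_of_nonpos_left hweight hneg
  nlinarith

/-- At a boundary minimum over the domain `{ht > 0}` the derivative is a nonnegative multiple of the
inner normal. -/
theorem exists_fderiv_eq_mul_inner_normal {ht g : Euc n → ℝ} {x ν : Euc n} {g' : Euc n →L[ℝ] ℝ}
    (hht : HasFDerivAt ht (innerSL ℝ ν) x) (h0 : ht x = 0) (hν : ‖ν‖ = 1)
    (hg : HasFDerivAt g g' x) (hmin : ∀ y, 0 < ht y → g x ≤ g y) :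
    ∃ a : ℝ, 0 ≤ a ∧ ∀ ξ, g' ξ = a * ⟪ν, ξ⟫ := by
  have hline (ξ : Euc n) : HasDerivAt (fun s : ℝ => x + s • ξ) ξ 0 := by
    simpa using ((hasDerivAt_id (0 : ℝ)).smul_const ξ).const_add x
  have hin (ξ : Euc n) (hξ : 0 < ⟪ν, ξ⟫) : 0 ≤ g' ξ := by
    have hht0 : HasFDerivAt ht (innerSL ℝ ν) (x + (0 : ℝ) • ξ) := by simpa using hht
    have hg0 : HasFDerivAt g g' (x + (0 : ℝ) • ξ) := by simpa using hg
    have h1 : HasDerivAt (fun s : ℝ => ht (x + s • ξ)) ⟪ν, ξ⟫ 0 := by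
      simpa [Function.comp_def] using hht0.comp_hasDerivAt (0 : ℝ) (hline ξ)
    have h2 : HasDerivAt (fun s : ℝ => g (x + s • ξ)) (g' ξ) 0 :=
      hg0.comp_hasDerivAt (0 : ℝ) (hline ξ)
    refine ge_of_tendsto h2.tendsto_slope_zero_right ?_
    filter_upwards [h1.tendsto_slope_zero_right.eventually (lt_mem_nhds hξ),
      self_mem_nhdsWithin] with t ht1 ht2
    have ht2 : 0 < t := ht2
    simp only [zero_add, zero_smul, add_zero, h0, sub_zero, smul_eq_mul] at ht1 ⊢
    have hpos : 0 < ht (x + t • ξ) := (pos_iff_pos_of_mul_pos ht1).1 (inv_pos.2 ht2)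
    exact mul_nonneg (inv_pos.2 ht2).le (sub_nonneg.2 (hmin _ hpos))
  have hνν : ⟪ν, ν⟫ = (1 : ℝ) := by rw [real_inner_self_eq_norm_sq, hν, one_pow]
  have htan (ζ : Euc n) (hζ : ⟪ν, ζ⟫ = 0) : g' ζ = 0 := by
    by_contra hne
    have := hin (ν + (-(g' ν + 1) / g' ζ) • ζ) (by
      rw [inner_add_right, inner_smul_right, hζ, hνν]; norm_num)
    rw [map_add, map_smul, smul_eq_mul, div_mul_cancel₀ _ hne] at this
    linarith
  refine ⟨g' ν, hin ν (by rw [hνν]; exact one_pos), fun ξ => ?_⟩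
  have := htan (ξ - ⟪ν, ξ⟫ • ν) (by
    rw [inner_sub_right, inner_smul_right, hνν, mul_one, sub_self])
  rw [map_sub, map_smul, smul_eq_mul] at this
  linarith

/-- Strict monotonicity of a gradient map along half-open segments of the domain. -/
theorem ne_of_inner_fderiv_pos {P : Euc n → Euc n} {x y : Euc n}
    (hd : ∀ t ∈ Icc (0 : ℝ) 1, DifferentiableAt ℝ P (y + t • (x - y)))
    (hpos : ∀ t ∈ Icc (0 : ℝ) 1,
      0 < ⟪fderiv ℝ P (y + t • (x - y)) (x - y), x - y⟫) : P x ≠ P y := by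
  intro heq
  have hline (t : ℝ) : HasDerivAt (fun s : ℝ => y + s • (x - y)) (x - y) t := by
    simpa using ((hasDerivAt_id t).smul_const (x - y)).const_add y
  have hd1 (t : ℝ) (ht : t ∈ Icc (0 : ℝ) 1) : HasDerivAt
      (fun s : ℝ => ⟪P (y + s • (x - y)), x - y⟫)
      ⟪fderiv ℝ P (y + t • (x - y)) (x - y), x - y⟫ t := by
    simpa using ((hd t ht).hasFDerivAt.comp_hasDerivAt t (hline t)).inner ℝ
      (hasDerivAt_const t (x - y))
  have hmono := strictMonoOn_of_deriv_pos (convex_Icc (0 : ℝ) 1)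
    (fun t ht => (hd1 t ht).continuousAt.continuousWithinAt)
    (fun t ht => by
      have ht' := interior_subset ht
      rw [(hd1 t ht').deriv]; exact hpos t ht')
  have := hmono (left_mem_Icc.2 zero_le_one) (right_mem_Icc.2 zero_le_one) zero_lt_one
  simp [heq] at this

/-- The lower bound for the obliqueness at a boundary minimum of the barrier. -/
theorem obliqueness_at_minimum {P H N : Euc n → Euc n} {h ht : Euc n → ℝ} {x : Euc n}
    {A δ θ θt : ℝ} (hδ : 0 < δ) (hθ : 0 ≤ θ)
    (hP : DifferentiableAt ℝ P x) (hH : DifferentiableAt ℝ H (P x)) (hN : DifferentiableAt ℝ N x)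
    (hh : HasFDerivAt h (innerSL ℝ (H (P x))) (P x)) (hht : HasFDerivAt ht (innerSL ℝ (N x)) x)
    (hsymm : ∀ ξ η, ⟪fderiv ℝ P x ξ, η⟫ = ⟪fderiv ℝ P x η, ξ⟫)
    (hpos : ∀ ξ, δ * ‖ξ‖ ^ 2 ≤ ⟪fderiv ℝ P x ξ, ξ⟫)
    (hconcH : ∀ ξ, ⟪fderiv ℝ H (P x) ξ, ξ⟫ ≤ -θ * ‖ξ‖ ^ 2)
    (hconcN : ∀ ξ, ⟪fderiv ℝ N x ξ, ξ⟫ ≤ -θt * ‖ξ‖ ^ 2)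
    (hHn : ‖H (P x)‖ = 1) (hNn : ‖N x‖ = 1) (hx : ht x = 0) (hPx : h (P x) = 0)
    (hdom : ∀ y, 0 < ht y → 0 ≤ h (P y))
    (hmin : ∀ y, 0 < ht y → ⟪H (P x), N x⟫ + A * ht x ≤ ⟪H (P y), N y⟫ + A * ht y) :
    θt ≤ A * ⟪H (P x), N x⟫ := by
  obtain ⟨a, ha, hae⟩ := exists_fderiv_eq_mul_inner_normal hht hx hNn
    (hh.comp x hP.hasFDerivAt) (fun y hy => by simpa [hPx] using hdom y hy)
  have hW : HasFDerivAt (fun y => ⟪H (P y), N y⟫ + A * ht y) _ x :=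
    ((hH.hasFDerivAt.comp x hP.hasFDerivAt).inner ℝ hN.hasFDerivAt).add (hht.const_mul A)
  obtain ⟨b, hb, hbe⟩ := exists_fderiv_eq_mul_inner_normal hht hx hNn hW hmin
  have hTβ : fderiv ℝ P x (H (P x)) = a • N x := by
    refine ext_inner_right ℝ fun ξ => ?_
    have := hae ξ
    rw [ContinuousLinearMap.comp_apply, innerSL_apply_apply] at this
    rw [hsymm, real_inner_comm, this, inner_smul_left, conj_trivial]
  have hχ : 0 < ⟪H (P x), N x⟫ := by
    have h1 := hpos (H (P x))
    rw [hTβ, inner_smul_left, conj_trivial, hHn, real_inner_comm] at h1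
    by_contra! hneg
    nlinarith [mul_nonneg ha (neg_nonneg.2 hneg)]
  have h2 := hbe (H (P x))
  simp only [_root_.add_apply, _root_.smul_apply, ContinuousLinearMap.comp_apply, smul_eq_mul,
    fderivInnerCLM_apply, ContinuousLinearMap.prod_apply, innerSL_apply_apply, hTβ, map_smul,
    inner_smul_left, conj_trivial, Function.comp_apply] at h2
  rw [real_inner_comm (H (P x)) (N x), real_inner_comm (fderiv ℝ N x (H (P x))) (H (P x))] at h2
  have h3 := hconcN (H (P x))
  have h4 := hconcH (N x)
  rw [hHn] at h3
  rw [hNn] at h4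
  have h5 := mul_nonneg hb hχ.le
  have h6 := mul_le_mul_of_nonneg_left h4 ha
  nlinarith [mul_nonneg ha hθ]

/-- Algebraic consequences of the equation for a nonnegative symmetric second derivative `T`. -/
theorem trace_bounds_of_equation {T : Euc n →L[ℝ] Euc n} {p : Euc n} {w₀ F : ℝ}
    (hsymm : ∀ ξ η, ⟪T ξ, η⟫ = ⟪T η, ξ⟫) (hpos : ∀ ξ, 0 ≤ ⟪T ξ, ξ⟫) (hw₀ : 0 < w₀)
    (hw : w₀ ≤ 1 - ‖p‖ ^ 2)
    (heq : (1 - ‖p‖ ^ 2) * √(1 - ‖p‖ ^ 2) * F =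
      (1 - ‖p‖ ^ 2) * ∑ i, ⟪T (EuclideanSpace.single i 1), EuclideanSpace.single i 1⟫ +
        ⟪p, T p⟫) :
    0 ≤ F ∧ ∑ i, ⟪T (EuclideanSpace.single i 1), EuclideanSpace.single i 1⟫ ≤ F ∧
      w₀ * √w₀ * F ≤
        (1 + n * n) * ∑ i, ⟪T (EuclideanSpace.single i 1), EuclideanSpace.single i 1⟫ := by
  have hT := opNorm_le_of_trace hsymm hpos le_rfl
  have htr : 0 ≤ ∑ i, ⟪T (EuclideanSpace.single i 1), EuclideanSpace.single i 1⟫ :=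
    Finset.sum_nonneg fun i _ => hpos _
  set tr := ∑ i, ⟪T (EuclideanSpace.single i 1), EuclideanSpace.single i 1⟫
  set w := 1 - ‖p‖ ^ 2 with hwdef
  have hw0 : 0 < w := hw₀.trans_le hw
  have hw1 : w ≤ 1 := by rw [hwdef]; nlinarith [sq_nonneg ‖p‖]
  have hp1 : ‖p‖ ^ 2 ≤ 1 := by linarith
  have hs0 : 0 < √w := Real.sqrt_pos.2 hw0
  have hs1 : √w ≤ 1 := Real.sqrt_le_one.2 hw1
  have hpT : 0 ≤ ⟪p, T p⟫ := by rw [real_inner_comm]; exact hpos p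
  have hpT' : ⟪p, T p⟫ ≤ n * n * tr := by
    calc ⟪p, T p⟫ ≤ ‖p‖ * ‖T p‖ := real_inner_le_norm _ _
      _ ≤ ‖p‖ * (‖T‖ * ‖p‖) := by gcongr; exact T.le_opNorm p
      _ = ‖p‖ ^ 2 * ‖T‖ := by ring
      _ ≤ 1 * ‖T‖ := by gcongr
      _ ≤ n * n * tr := by rwa [one_mul]
  have hF : 0 ≤ F := by
    by_contra! hneg
    nlinarith [mul_pos (mul_pos hw0 hs0) (neg_pos.2 hneg), mul_nonneg hw0.le htr]
  refine ⟨hF, ?_, ?_⟩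
  · have h1 : w * tr ≤ w * (√w * F) := by linarith
    have h2 := le_of_mul_le_mul_left h1 hw0
    nlinarith
  · have h1 : w₀ * √w₀ * F ≤ w * √w * F := by gcongr
    nlinarith [mul_le_mul_of_nonneg_right hw1 htr]

theorem IsSmoothSol.contDiffAt {Ω Ωt : Set (Euc n)} {f : Euc n × Euc n → ℝ} {c : ℝ}
    {u : Euc n → ℝ} (hu : IsSmoothSol Ω Ωt f c u) (hΩ : IsOpen Ω) {x : Euc n} (hx : x ∈ Ω) :
    ContDiffAt ℝ (⊤ : ℕ∞) u x :=
  hu.1.contDiffAt (Filter.mem_of_superset (hΩ.mem_nhds hx) subset_closure)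

theorem IsSmoothSol.gradient_mem {Ω Ωt : Set (Euc n)} {f : Euc n × Euc n → ℝ} {c : ℝ}
    {u : Euc n → ℝ} (hu : IsSmoothSol Ω Ωt f c u) {x : Euc n} (hx : x ∈ Ω) :
    gradient u x ∈ Ωt :=
  hu.2.2.2.2 ▸ mem_image_of_mem _ hx

theorem IsSmoothSol.equation {Ω Ωt : Set (Euc n)} {f : Euc n × Euc n → ℝ} {c : ℝ}
    {u : Euc n → ℝ} (hu : IsSmoothSol Ω Ωt f c u) (hΩ : IsOpen Ω) {x : Euc n} (hx : x ∈ Ω) :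
    (1 - ‖gradient u x‖ ^ 2) * √(1 - ‖gradient u x‖ ^ 2) * (f (x, gradient u x) + c) =
      (1 - ‖gradient u x‖ ^ 2) * ∑ i, ⟪fderiv ℝ (gradient u) x (EuclideanSpace.single i 1),
        EuclideanSpace.single i 1⟫ +
      ⟪gradient u x, fderiv ℝ (gradient u) x (gradient u x)⟫ := by
  rw [← hu.2.2.2.1 x hx]
  exact MinkDiv_eq ((hu.contDiffAt hΩ hx).gradient.differentiableAt (by simp))
    (hu.2.2.1 x (subset_closure hx))

/-- A solution, having gradient valued in the unit ball, has controlled constant `c`, and hence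
controlled right-hand side and Laplacian. -/
theorem IsSmoothSol.second_order_bounds (hn : 0 < n) {Ω Ωt : Set (Euc n)} {f : Euc n × Euc n → ℝ}
    {c : ℝ} {u : Euc n → ℝ} (hu : IsSmoothSol Ω Ωt f c u) (hΩ : IsOpen Ω) {K w₀ r : ℝ} {z : Euc n}
    (hf : C2Bound Ω Ωt f K) (hw₀ : 0 < w₀) (hw : ∀ p ∈ closure Ωt, w₀ ≤ 1 - ‖p‖ ^ 2) (hr : 0 < r)
    (hz : Metric.closedBall z r ⊆ Ω) {x : Euc n} (hx : x ∈ Ω) :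
    0 ≤ f (x, gradient u x) + c ∧
      f (x, gradient u x) + c ≤ 2 * K + 2 * n / r * (1 + n * n) / (w₀ * √w₀) ∧
      0 ≤ ∑ i, ⟪fderiv ℝ (gradient u) x (EuclideanSpace.single i 1),
        EuclideanSpace.single i 1⟫ ∧
      ∑ i, ⟪fderiv ℝ (gradient u) x (EuclideanSpace.single i 1),
        EuclideanSpace.single i 1⟫ ≤ 2 * K + 2 * n / r * (1 + n * n) / (w₀ * √w₀) ∧
      ‖fderiv ℝ (gradient u) x‖ ≤ n * n * (2 * K + 2 * n / r * (1 + n * n) / (w₀ * √w₀)) := by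
  obtain ⟨δ, hδ, hconv⟩ := hu.2.1
  have hd (y) (hy : y ∈ Ω) := (hconv y (subset_closure hy)).differentiableAt_fderiv hn hδ
  have hsymm (y) (hy : y ∈ Ω) := (hconv y (subset_closure hy)).inner_fderiv_gradient_comm (hd y hy)
  have hpos (y) (hy : y ∈ Ω) (ξ : Euc n) : 0 ≤ ⟪fderiv ℝ (gradient u) y ξ, ξ⟫ :=
    (by positivity : 0 ≤ δ * ‖ξ‖ ^ 2).trans ((hconv y (subset_closure hy)).le_inner (hd y hy) ξ)
  have hwP (y) (hy : y ∈ Ω) := hw _ (subset_closure (hu.gradient_mem hy))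
  have hfP (y) (hy : y ∈ Ω) : |f (y, gradient u y)| ≤ K :=
    (hf.2 _ ⟨subset_closure hy, subset_closure (hu.gradient_mem hy)⟩).1
  have hb (y) (hy : y ∈ Ω) := trace_bounds_of_equation (hsymm y hy) (hpos y hy) hw₀ (hwP y hy)
    (hu.equation hΩ hy)
  have hs : 0 < w₀ * √w₀ := mul_pos hw₀ (Real.sqrt_pos.2 hw₀)
  have hn1 : (0 : ℝ) < 1 + n * n := by positivity
  have hm := trace_le_of_gradient_le_one hn (u := u) (m := w₀ * √w₀ * (c - K) / (1 + n * n)) hr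
    (fun y hy => (hu.contDiffAt hΩ (hz hy)).differentiableAt (by simp))
    (fun y hy => (hd y (hz hy)).gradient)
    (fun y hy => (hu.2.2.1 y (subset_closure (hz hy))).le)
    (fun y hy => by
      rw [div_le_iff₀ hn1, mul_comm _ (1 + (n : ℝ) * n)]
      refine le_trans ?_ (hb y (hz hy)).2.2
      gcongr
      linarith [(abs_le.1 (hfP y (hz hy))).1])
  have hc : c - K ≤ 2 * n / r * (1 + n * n) / (w₀ * √w₀) := by
    rw [le_div_iff₀ hs, mul_comm]
    exact (div_le_iff₀ hn1).1 hm
  have hF : f (x, gradient u x) + c ≤ 2 * K + 2 * n / r * (1 + n * n) / (w₀ * √w₀) := by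
    linarith [(abs_le.1 (hfP x hx)).2]
  have htr := (hb x hx).2.1.trans hF
  exact ⟨(hb x hx).1, hF, Finset.sum_nonneg fun i _ => hpos x hx _, htr,
    opNorm_le_of_trace (hsymm x hx) (hpos x hx) htr⟩

/-- Bound for the linearized operator applied to the gradient of a solution. -/
theorem IsSmoothSol.third_order_bound (hn : 0 < n) {Ω Ωt : Set (Euc n)} {f : Euc n × Euc n → ℝ}
    {c : ℝ} {u : Euc n → ℝ} (hu : IsSmoothSol Ω Ωt f c u) (hΩ : IsOpen Ω) (hΩt : IsOpen Ωt)
    {K Λ τ : ℝ} (hf : C2Bound Ω Ωt f K) {x : Euc n} (hx : x ∈ Ω)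
    (hF : |f (x, gradient u x) + c| ≤ τ)
    (hτ : |∑ i, ⟪fderiv ℝ (gradient u) x (EuclideanSpace.single i 1),
        EuclideanSpace.single i 1⟫| ≤ τ)
    (hΛ : ‖fderiv ℝ (gradient u) x‖ ≤ Λ) :
    ‖(1 - ‖gradient u x‖ ^ 2) • ∑ i, fderiv ℝ (fderiv ℝ (gradient u)) x
        (EuclideanSpace.single i 1) (EuclideanSpace.single i 1) +
        fderiv ℝ (fderiv ℝ (gradient u)) x (gradient u x) (gradient u x)‖ ≤
      2 * Λ * τ + 2 * Λ ^ 2 + 3 * Λ * τ + K * (1 + Λ) := by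
  obtain ⟨δ, hδ, hconv⟩ := hu.2.1
  have hPc := (hu.contDiffAt hΩ hx).gradient
  have hP : DifferentiableAt ℝ (gradient u) x := hPc.differentiableAt (by simp)
  have hP2 : DifferentiableAt ℝ (fderiv ℝ (gradient u)) x :=
    (hPc.fderiv_right (m := (⊤ : ℕ∞)) (by simp)).differentiableAt (by simp)
  have hmem : (x, gradient u x) ∈ closure Ω ×ˢ closure Ωt :=
    ⟨subset_closure hx, subset_closure (hu.gradient_mem hx)⟩
  have hfd : DifferentiableAt ℝ f (x, gradient u x) :=
    (hf.1.contDiffAt (prod_mem_nhds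
      (Filter.mem_of_superset (hΩ.mem_nhds hx) subset_closure)
      (Filter.mem_of_superset (hΩt.mem_nhds (hu.gradient_mem hx))
        subset_closure))).differentiableAt (by simp)
  have hFd : HasFDerivAt (fun y => f (y, gradient u y) + c)
      ((fderiv ℝ f (x, gradient u x)).comp
        ((ContinuousLinearMap.id ℝ (Euc n)).prod (fderiv ℝ (gradient u) x))) x :=
    (hfd.hasFDerivAt.comp x ((hasFDerivAt_id x).prodMk hP.hasFDerivAt)).add_const c
  have hK0 : 0 ≤ K := (norm_nonneg _).trans (hf.2 _ hmem).2.1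
  have hF' : ‖(fderiv ℝ f (x, gradient u x)).comp
      ((ContinuousLinearMap.id ℝ (Euc n)).prod (fderiv ℝ (gradient u) x))‖ ≤ K * (1 + Λ) := by
    refine (ContinuousLinearMap.opNorm_comp_le _ _).trans
      (mul_le_mul (hf.2 _ hmem).2.1 ?_ (norm_nonneg _) hK0)
    rw [ContinuousLinearMap.opNorm_prod]
    refine (norm_prod_le_iff.2 ⟨?_, ?_⟩)
    · exact ContinuousLinearMap.norm_id_le.trans (by linarith [(norm_nonneg _).trans hΛ])
    · linarith
  refine norm_third_order_le hP hP2 (hu.2.2.1 x (subset_closure hx)) hFd ?_ ?_ ?_ hΛ hτ hF hF'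
  · filter_upwards [hΩ.mem_nhds hx] with y hy using hu.equation hΩ hy
  · filter_upwards [hΩ.mem_nhds hx] with y hy
    have hy' := hconv y (subset_closure hy)
    exact hy'.inner_fderiv_gradient_comm (hy'.differentiableAt_fderiv hn hδ)
  · exact (hPc.isSymmSndFDerivAt (by
      simpa using WithTop.coe_le_coe.2 (le_top : (2 : ℕ∞) ≤ ⊤))).eq

/-- The gradient of a solution maps the boundary of the domain to the boundary of the target. -/
theorem IsSmoothSol.gradient_mem_frontier (hn : 0 < n) {Ω Ωt : Set (Euc n)}
    {f : Euc n × Euc n → ℝ} {c : ℝ} {u ht : Euc n → ℝ} (hu : IsSmoothSol Ω Ωt f c u)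
    (hΩt : IsOpen Ωt) (hht : ContDiff ℝ (⊤ : ℕ∞) ht) (hΩ : Ω = {x | 0 < ht x})
    (hconc : ∀ x ξ : Euc n, ⟪fderiv ℝ (gradient ht) x ξ, ξ⟫ ≤ 0) {x : Euc n}
    (hx : x ∈ frontier Ω) : gradient u x ∈ frontier Ωt := by
  obtain ⟨δ, hδ, hconv⟩ := hu.2.1
  have hΩo : IsOpen Ω := hΩ ▸ isOpen_lt continuous_const hht.continuous
  have hd (y) (hy : y ∈ closure Ω) := (hconv y hy).differentiableAt_fderiv hn hδ
  have hxc : x ∈ closure Ω := frontier_subset_closure hx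
  have hxΩ : x ∉ Ω := by
    rw [hΩo.frontier_eq] at hx
    exact hx.2
  have hx0 : 0 ≤ ht x := closure_minimal (hΩ ▸ fun y (hy : 0 < ht y) => hy.le)
    (isClosed_le continuous_const hht.continuous) hxc
  rw [hΩt.frontier_eq]
  refine ⟨?_, fun hmem => ?_⟩
  · exact closure_mono (hu.2.2.2.2.subset)
      ((hd x hxc).gradient.continuousAt.continuousWithinAt.mem_closure_image hxc)
  · rw [← hu.2.2.2.2] at hmem
    obtain ⟨y, hy, hyx⟩ := hmem
    have hseg (t : ℝ) (ht' : t ∈ Icc (0 : ℝ) 1) : y + t • (x - y) ∈ closure Ω := by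
      rcases ht'.2.eq_or_lt with rfl | hlt
      · simpa using hxc
      · refine subset_closure ?_
        rw [hΩ] at hy ⊢
        exact pos_of_hess_nonpos hht hconc hy hx0 ht'.1 hlt
    have hne : 0 < ‖x - y‖ := norm_pos_iff.2 (sub_ne_zero.2 fun h => hxΩ (h ▸ hy))
    exact ne_of_inner_fderiv_pos (fun t ht' => (hd _ (hseg t ht')).gradient)
      (fun t ht' => (by positivity : 0 < δ * ‖x - y‖ ^ 2).trans_le
        ((hconv _ (hseg t ht')).le_inner (hd _ (hseg t ht')) _)) hyx.symm

/-- A smooth vector field is bounded in `C²` on compact sets. -/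
theorem exists_bound_two_derivatives {G : Euc n → Euc n} (hG : ContDiff ℝ (⊤ : ℕ∞) G)
    {s : Set (Euc n)} (hs : IsCompact s) :
    ∃ M : ℝ, ∀ x ∈ s, ‖G x‖ ≤ M ∧ ‖fderiv ℝ G x‖ ≤ M ∧ ‖fderiv ℝ (fderiv ℝ G) x‖ ≤ M := by
  obtain ⟨M₀, h₀⟩ := hs.exists_bound_of_continuousOn hG.continuous.continuousOn
  have hG1 : ContDiff ℝ (⊤ : ℕ∞) (fderiv ℝ G) := hG.fderiv_right (by simp)
  obtain ⟨M₁, h₁⟩ := hs.exists_bound_of_continuousOn hG1.continuous.continuousOn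
  obtain ⟨M₂, h₂⟩ := hs.exists_bound_of_continuousOn
    (hG1.fderiv_right (m := (⊤ : ℕ∞)) (by simp)).continuous.continuousOn
  exact ⟨max M₀ (max M₁ M₂), fun x hx => ⟨le_max_of_le_left (h₀ x hx),
    le_max_of_le_right (le_max_of_le_left (h₁ x hx)),
    le_max_of_le_right (le_max_of_le_right (h₂ x hx))⟩⟩

theorem hasFDerivAt_innerSL_gradient {h : Euc n → ℝ} (hh : ContDiff ℝ (⊤ : ℕ∞) h) (y : Euc n) :
    HasFDerivAt h (innerSL ℝ (gradient h y)) y := by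
  have heq : innerSL ℝ (gradient h y) = fderiv ℝ h y := by
    ext ξ
    rw [innerSL_apply_apply, inner_gradient_left]
  rw [heq]
  exact (hh.differentiable (by simp) y).hasFDerivAt

theorem statement_11 {n : ℕ} (hn : 2 ≤ n)
    (Ω Ωt : Set (Euc n)) (ht h : Euc n → ℝ) (θt θ : ℝ)
    (hdom : DomainSetup Ω Ωt ht h θt θ)
    (hball : closure Ωt ⊆ Metric.ball (0 : Euc n) 1)
    :
    ∀ K : ℝ, 0 < K →
      ∃ ε C₁₃ : ℝ, 0 < ε ∧ 0 < C₁₃ ∧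
        ∀ f : Euc n × Euc n → ℝ, InA Ω Ωt f → C2Bound Ω Ωt f K → OSCcond Ω Ωt f →
          DxBound Ω Ωt f ε →
        ∀ (c : ℝ) (u : Euc n → ℝ), IsSmoothSol Ω Ωt f c u →
        ∀ x ∈ frontier Ω, 1 / C₁₃ ≤ ⟪gradient h (gradient u x), gradient ht x⟫ := by
  intro K hK
  obtain ⟨hΩ, hΩt, hΩb, hΩtb, ⟨z, hz⟩, hΩtne, hht, hh, hΩeq, hΩteq, hνt, hν, hθt, hθ, hHt, hH⟩ :=
    hdom
  have hn0 : 0 < n := by omega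
  have hcΩ : IsCompact (closure Ω) := hΩb.isCompact_closure
  have hcΩt : IsCompact (closure Ωt) := hΩtb.isCompact_closure
  obtain ⟨r, hr, hzr⟩ := Metric.nhds_basis_closedBall.mem_iff.1 (hΩ.mem_nhds hz)
  obtain ⟨w₀, hw₀, hw⟩ : ∃ w₀ : ℝ, 0 < w₀ ∧ ∀ p ∈ closure Ωt, w₀ ≤ 1 - ‖p‖ ^ 2 := by
    obtain ⟨q, hq, hqmin⟩ := hcΩt.exists_isMinOn (f := fun p : Euc n => 1 - ‖p‖ ^ 2)
      hΩtne.closure (by fun_prop)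
    have hq1 : ‖q‖ < 1 := by simpa using hball hq
    exact ⟨1 - ‖q‖ ^ 2, by nlinarith [norm_nonneg q], hqmin⟩
  have hHc := contDiff_gradient hh
  have hNc := contDiff_gradient hht
  obtain ⟨M₁, hM₁⟩ := exists_bound_two_derivatives hHc hcΩt
  obtain ⟨M₂, hM₂⟩ := exists_bound_two_derivatives hNc hcΩ
  set M := max M₁ M₂
  have hM₁M : M₁ ≤ M := le_max_left _ _
  have hM₂M : M₂ ≤ M := le_max_right _ _
  set τ := 2 * K + 2 * n / r * (1 + n * n) / (w₀ * √w₀)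
  have hτ : 0 < τ := by positivity
  set Λ := n * n * τ
  have hΛ : 0 < Λ := by positivity
  set C := 2 * Λ * τ + 2 * Λ ^ 2 + 3 * Λ * τ + K * (1 + Λ)
  have hC : 0 < C := by positivity
  set A := (M ^ 2 * (C + (Λ + 1) ^ 2) + 1) / θt
  have hA : 0 < A := by positivity
  have hAθ : M ^ 2 * (C + (Λ + 1) ^ 2) < A * θt := by
    rw [div_mul_cancel₀ _ hθt.ne']; linarith
  refine ⟨1, A / θt, one_pos, by positivity, fun f _ hf _ _ c u hu x hx => ?_⟩
  have hconcN (y ξ : Euc n) := (hHt y).inner_le (hht.differentiable_fderiv_top y) ξ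
  have hconcH (y ξ : Euc n) := (hH y).inner_le (hh.differentiable_fderiv_top y) ξ
  have hconcN0 (y ξ : Euc n) : ⟪fderiv ℝ (gradient ht) y ξ, ξ⟫ ≤ 0 := by
    nlinarith [hconcN y ξ, sq_nonneg ‖ξ‖]
  have hfrontier (y : Euc n) (hy : y ∈ frontier Ω) : gradient u y ∈ frontier Ωt :=
    hu.gradient_mem_frontier hn0 hΩt hht hΩeq hconcN0 hy
  have hzero {g : Euc n → ℝ} (hg : Continuous g) {y : Euc n} (hy : y ∈ frontier {x | 0 < g x}) :
      g y = 0 := (frontier_lt_subset_eq continuous_const hg hy).symm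
  obtain ⟨δ, hδ, hconv⟩ := hu.2.1
  have hd (y) (hy : y ∈ closure Ω) : DifferentiableAt ℝ (fderiv ℝ u) y :=
    (hconv y hy).differentiableAt_fderiv hn0 hδ
  set W : Euc n → ℝ := fun y => ⟪gradient h (gradient u y), gradient ht y⟫ + A * ht y with hW
  have hWc : ContinuousOn W (closure Ω) := fun y hy =>
    (((hHc.continuous.continuousAt.comp (hd y hy).gradient.continuousAt).inner
      hNc.continuous.continuousAt).add
      (continuousAt_const.mul hht.continuous.continuousAt)).continuousWithinAt
  obtain ⟨x₀, hx₀, hmin⟩ := hcΩ.exists_isMinOn ⟨z, subset_closure hz⟩ hWc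
  have hx₀Ω : x₀ ∉ Ω := by
    intro hmem
    obtain ⟨hF0, hF1, ht0, ht1, hT⟩ := hu.second_order_bounds hn0 hΩ hf hw₀ hw hr hzr hmem
    have hR := hu.third_order_bound hn0 hΩ hΩt hf hmem (abs_le.2 ⟨by linarith, hF1⟩)
      (abs_le.2 ⟨by linarith, ht1⟩) hT
    have hP2 : DifferentiableAt ℝ (fderiv ℝ (gradient u)) x₀ :=
      ((hu.contDiffAt hΩ hmem).gradient.fderiv_right
        (m := (⊤ : ℕ∞)) (by simp)).differentiableAt (by simp)
    have hb₁ := hM₁ _ (subset_closure (hu.gradient_mem hmem))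
    have hb₂ := hM₂ _ hx₀
    refine not_isLocalMin_barrier hn0 ?_ hP2 (hu.2.2.1 x₀ hx₀) (hHc.differentiable (by simp))
      hHc.differentiable_fderiv_top (hNc.differentiable (by simp)) hNc.differentiable_fderiv_top
      (hasFDerivAt_innerSL_gradient hht) (hb₁.1.trans hM₁M) (hb₁.2.1.trans hM₁M)
      (hb₁.2.2.trans hM₁M) (hb₂.1.trans hM₂M) (hb₂.2.1.trans hM₂M) (hb₂.2.2.trans hM₂M)
      (hconcN x₀) hT hR hA.le hAθ
      (hmin.isLocalMin (Filter.mem_of_superset (hΩ.mem_nhds hmem) subset_closure))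
    filter_upwards [hΩ.mem_nhds hmem] with y hy using (hd y (subset_closure hy)).gradient
  have hx₀f : x₀ ∈ frontier Ω := by
    rw [hΩ.frontier_eq]
    exact ⟨hx₀, hx₀Ω⟩
  have hobl : θt ≤ A * ⟪gradient h (gradient u x₀), gradient ht x₀⟫ := by
    refine obliqueness_at_minimum hδ hθ.le (hd x₀ hx₀).gradient
      (hHc.differentiable (by simp) _) (hNc.differentiable (by simp) _)
      (hasFDerivAt_innerSL_gradient hh _) (hasFDerivAt_innerSL_gradient hht _)
      ((hconv x₀ hx₀).inner_fderiv_gradient_comm (hd x₀ hx₀))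
      ((hconv x₀ hx₀).le_inner (hd x₀ hx₀)) (hconcH _) (hconcN x₀)
      (hν _ (hfrontier x₀ hx₀f)) (hνt x₀ hx₀f) (hzero hht.continuous (hΩeq ▸ hx₀f))
      (hzero hh.continuous (hΩteq ▸ hfrontier x₀ hx₀f)) (fun y hy => ?_) (fun y hy => ?_)
    · have hy' : gradient u y ∈ Ωt := hu.gradient_mem (by rw [hΩeq]; exact hy)
      rw [hΩteq] at hy'
      exact le_of_lt hy'
    · exact hmin (subset_closure (by rw [hΩeq]; exact hy))
  have hle : W x₀ ≤ W x := hmin (frontier_subset_closure hx)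
  simp only [hW, hzero hht.continuous (hΩeq ▸ hx₀f), hzero hht.continuous (hΩeq ▸ hx), mul_zero,
    add_zero] at hle
  rw [one_div_div, div_le_iff₀' hA]
  exact hobl.trans (by gcongr)

end
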